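/- Let δ ∈ (0,1/2). Then the partial sums S_N(ξ) := Σ_{p=0}^{N} γ_p^{(δ)} e^{i p ξ} converge, as N → ∞, in L²([0,2π]) to the function ξ ↦ (1 − e^{iξ})^{−δ}, where for ξ ∈ (0,2π) the quantity (1 − e^{iξ})^{−δ} denotes the principal-branch complex power exp(−δ · Log(1 − e^{iξ})). -/

import Mathlib

open scoped Real

/-- The FARIMA coefficients `γ_p^{(δ)}`:
`γ_0 = 1`, `γ_p = δ Γ(p+δ)/(Γ(p+1) Γ(δ+1))` for `p ≥ 1`, and `γ_p = 0` for `p < 0`. -/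
noncomputable def gammaCoef (δ : ℝ) (p : ℤ) : ℝ :=
  if p = 0 then 1
  else if 0 < p then δ * Real.Gamma ((p : ℝ) + δ) / (Real.Gamma ((p : ℝ) + 1) * Real.Gamma (δ + 1))
  else 0

theorem gammaCoef_natCast_eq_choose {δ : ℝ} (hδ : 0 < δ) (p : ℕ) :
    gammaCoef δ p = Ring.choose (δ + p - 1) p := by
  have hΓ : Real.Gamma δ ≠ 0 := (Real.Gamma_pos_of_pos hδ).ne'
  have hasc : (ascPochhammer ℝ p).eval δ = Real.Gamma (p + δ) / Real.Gamma δ := by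
    induction p with
    | zero => simp [hΓ]
    | succ n ih =>
      have h : Real.Gamma (↑(n + 1) + δ) = (n + δ) * Real.Gamma (n + δ) := by
        rw [← Real.Gamma_add_one (by positivity)]
        congr 1
        push_cast
        ring
      rw [ascPochhammer_succ_eval, ih, h]
      ring
  have hchoose : (p.factorial : ℝ) * Ring.choose (δ + p - 1) p =
      Real.Gamma (p + δ) / Real.Gamma δ := by
    rw [← hasc, ← Ring.multichoose_eq, ← nsmul_eq_mul,
      Ring.factorial_nsmul_multichoose_eq_ascPochhammer,
      Polynomial.ascPochhammer_smeval_eq_eval]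
  have hp : (p.factorial : ℝ) ≠ 0 := by positivity
  rcases Nat.eq_zero_or_pos p with rfl | hpos
  · simp [gammaCoef]
  · rw [← mul_right_inj' hp, hchoose, gammaCoef, if_neg (by positivity), if_pos (by positivity),
      Real.Gamma_add_one hδ.ne']
    push_cast
    rw [Real.Gamma_nat_eq_factorial]
    field_simp

theorem hasSum_gammaCoef_mul_pow {δ : ℝ} (hδ : 0 < δ) {z : ℂ} (hz : ‖z‖ < 1) :
    HasSum (fun p : ℕ => (gammaCoef δ p : ℂ) * z ^ p) ((1 - z) ^ (-(δ : ℂ))) := by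
  have h := (Complex.one_div_one_sub_cpow_hasFPowerSeriesOnBall_zero (δ : ℂ)).hasSum
    (y := z) (by simpa [Metric.mem_eball, edist_zero_right, enorm_eq_nnnorm] using! hz)
  simp only [zero_add, one_div, ← Complex.cpow_neg, FormalMultilinearSeries.ofScalars_apply_eq,
    smul_eq_mul] at h
  have hcoef (p : ℕ) : (gammaCoef δ p : ℂ) = Ring.choose ((δ : ℂ) + p - 1) p := by
    rw [gammaCoef_natCast_eq_choose hδ, Complex.ofReal_choose]
    push_cast
    rfl
  simpa only [hcoef] using h

theorem integral_exp_I_mul_int_mul (n : ℤ) :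
    ∫ ξ in (0 : ℝ)..(2 * π), Complex.exp (Complex.I * n * ξ) = if n = 0 then (2 * π : ℂ) else 0 := by
  split_ifs with hn
  · simp [hn]
  · rw [integral_exp_mul_complex (by simp [hn])]
    have h : Complex.exp (Complex.I * n * ((2 * π : ℝ) : ℂ)) = 1 := by
      rw [← Complex.exp_int_mul_two_pi_mul_I n]
      push_cast
      ring_nf
    rw [h]
    simp

theorem norm_one_sub_exp_I_mul (ξ : ℝ) :
    ‖1 - Complex.exp (Complex.I * ξ)‖ = 2 * |Real.sin (ξ / 2)| := by
  rw [norm_sub_rev, Complex.norm_exp_I_mul_ofReal_sub_one]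
  simp

theorem norm_one_sub_exp_I_mul_pos {ξ : ℝ} (hξ : ξ ∈ Set.Ioo 0 (2 * π)) :
    0 < ‖1 - Complex.exp (Complex.I * ξ)‖ := by
  have h := Real.sin_pos_of_pos_of_lt_pi (x := ξ / 2) (by linarith [hξ.1]) (by linarith [hξ.2])
  rw [norm_one_sub_exp_I_mul]
  positivity

theorem intervalIntegrable_norm_one_sub_exp_rpow {s : ℝ} (hs0 : s ≤ 0) (hs : -1 < s) :
    IntervalIntegrable (fun ξ : ℝ => ‖1 - Complex.exp (Complex.I * ξ)‖ ^ s)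
      MeasureTheory.volume 0 (2 * π) := by
  have hπ := Real.pi_pos
  have hpow : IntervalIntegrable (fun ξ : ℝ => ξ ^ s) MeasureTheory.volume 0 (2 * π) :=
    intervalIntegral.intervalIntegrable_rpow' hs
  have hrev : IntervalIntegrable (fun ξ : ℝ => (2 * π - ξ) ^ s) MeasureTheory.volume 0 (2 * π) := by
    simpa using (hpow.comp_sub_left (2 * π)).symm
  refine ((hpow.add hrev).const_mul ((2 / π) ^ s)).mono_fun'
    (by
      have hm : Measurable fun ξ : ℝ => ‖1 - Complex.exp (Complex.I * ξ)‖ := by fun_prop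
      exact (hm.pow_const s).aestronglyMeasurable) ?_
  rw [Set.uIoc_of_le (by positivity), ← MeasureTheory.Measure.restrict_congr_set
    MeasureTheory.Ioo_ae_eq_Ioc]
  filter_upwards [MeasureTheory.ae_restrict_mem measurableSet_Ioo] with ξ hξ
  obtain ⟨h0, h1⟩ := hξ
  rw [Real.norm_of_nonneg (by positivity), norm_one_sub_exp_I_mul]
  have h1' : 0 < 2 * π - ξ := by linarith
  rw [mul_add, ← Real.mul_rpow (by positivity) h0.le, ← Real.mul_rpow (by positivity) h1'.le]
  rcases le_total ξ π with h | h
  · have hsin := Real.mul_le_sin (x := ξ / 2) (by linarith) (by linarith)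
    refine le_add_of_le_of_nonneg (Real.rpow_le_rpow_of_nonpos (by positivity) ?_ hs0)
      (by positivity)
    linarith [le_abs_self (Real.sin (ξ / 2))]
  · have hsin := Real.mul_le_sin (x := π - ξ / 2) (by linarith) (by linarith)
    rw [Real.sin_pi_sub] at hsin
    refine le_add_of_nonneg_of_le (by positivity) (Real.rpow_le_rpow_of_nonpos (by positivity) ?_ hs0)
    linarith [le_abs_self (Real.sin (ξ / 2))]

theorem norm_one_sub_le_two_mul_norm_one_sub_mul {z : ℂ} (hz : ‖z‖ = 1) {r : ℝ} (hr : r ≤ 1)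
    (hr0 : 0 ≤ r) :
    ‖1 - z‖ ≤ 2 * ‖1 - r * z‖ := by
  have h1 : ‖1 - z‖ ≤ ‖1 - r * z‖ + (1 - r) := by
    calc ‖1 - z‖ = ‖(1 - r * z) - ((1 - r : ℝ) : ℂ) * z‖ := by push_cast; ring_nf
      _ ≤ ‖1 - r * z‖ + ‖((1 - r : ℝ) : ℂ) * z‖ := norm_sub_le _ _
      _ = ‖1 - r * z‖ + (1 - r) := by
        rw [norm_mul, hz, mul_one, Complex.norm_real, Real.norm_of_nonneg (by linarith)]
  have h2 : 1 - r ≤ ‖1 - r * z‖ := by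
    have := norm_sub_norm_le (1 : ℂ) (r * z)
    rwa [norm_one, norm_mul, hz, mul_one, Complex.norm_real, Real.norm_of_nonneg hr0] at this
  linarith

theorem norm_exp_I_mul (n : ℤ) (ξ : ℝ) : ‖Complex.exp (Complex.I * n * ξ)‖ = 1 := by
  simp [Complex.norm_exp]

theorem integral_exp_mul_one_sub_mul_exp_cpow {δ : ℝ} (hδ : 0 < δ) (n : ℤ) {r : ℝ} (hr0 : 0 ≤ r)
    (hr : r < 1) :
    ∫ ξ in (0 : ℝ)..(2 * π), Complex.exp (Complex.I * (-n : ℤ) * ξ) *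
        (1 - r * Complex.exp (Complex.I * ξ)) ^ (-(δ : ℂ)) =
      2 * π * (gammaCoef δ n * r ^ n.toNat) := by
  have hsumm : Summable fun p : ℕ => ‖(gammaCoef δ p : ℂ) * (r : ℂ) ^ p‖ :=
    (hasSum_gammaCoef_mul_pow hδ (z := (r : ℂ))
      (by rwa [Complex.norm_real, Real.norm_of_nonneg hr0])).summable.norm
  have hswap := intervalIntegral.hasSum_integral_of_dominated_convergence
    (μ := MeasureTheory.volume) (a := 0) (b := 2 * π)
    (F := fun (p : ℕ) (ξ : ℝ) =>
      (gammaCoef δ p : ℂ) * (r : ℂ) ^ p * Complex.exp (Complex.I * (p - n : ℤ) * ξ))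
    (f := fun ξ : ℝ => Complex.exp (Complex.I * (-n : ℤ) * ξ) *
        (1 - r * Complex.exp (Complex.I * ξ)) ^ (-(δ : ℂ)))
    (fun p _ => ‖(gammaCoef δ p : ℂ) * (r : ℂ) ^ p‖)
    (fun p => by fun_prop)
    (fun p => Filter.Eventually.of_forall fun ξ _ => by
      rw [norm_mul, norm_exp_I_mul, mul_one])
    (Filter.Eventually.of_forall fun ξ _ => hsumm)
    (by simp)
    (Filter.Eventually.of_forall fun ξ _ => by
      have h := (hasSum_gammaCoef_mul_pow hδ (z := r * Complex.exp (Complex.I * ξ))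
        (by
          have := norm_exp_I_mul 1 ξ
          rw [Int.cast_one, mul_one] at this
          rwa [norm_mul, this, mul_one, Complex.norm_real, Real.norm_of_nonneg hr0])).mul_left
            (Complex.exp (Complex.I * (-n : ℤ) * ξ))
      have hexp (p : ℕ) : Complex.exp (Complex.I * (-n : ℤ) * ξ) *
          ((gammaCoef δ p : ℂ) * (r * Complex.exp (Complex.I * ξ)) ^ p) =
          (gammaCoef δ p : ℂ) * (r : ℂ) ^ p * Complex.exp (Complex.I * (p - n : ℤ) * ξ) := by
        have : Complex.exp (Complex.I * (p - n : ℤ) * ξ) =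
            Complex.exp (Complex.I * (-n : ℤ) * ξ) * Complex.exp (Complex.I * ξ) ^ p := by
          rw [← Complex.exp_nat_mul, ← Complex.exp_add]
          push_cast
          ring_nf
        rw [this]
        ring
      simpa only [hexp] using h)
  simp only [intervalIntegral.integral_const_mul, integral_exp_I_mul_int_mul] at hswap
  rw [← hswap.tsum_eq]
  rcases lt_or_ge n 0 with hn | hn
  · have hne (p : ℕ) : (p : ℤ) - n ≠ 0 := by omega
    simp [hne, gammaCoef, hn.ne, hn.not_gt]
  · lift n to ℕ using hn
    rw [tsum_eq_single n]
    · simp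
      ring
    · intro p hp
      simp [sub_eq_zero, hp]

theorem one_sub_exp_I_mul_mem_slitPlane {ξ : ℝ} (hξ : ξ ∈ Set.Ioo 0 (2 * π)) :
    1 - Complex.exp (Complex.I * ξ) ∈ Complex.slitPlane := by
  have h := Real.sin_pos_of_pos_of_lt_pi (x := ξ / 2) (by linarith [hξ.1]) (by linarith [hξ.2])
  have hre : (Complex.exp (Complex.I * ξ)).re = Real.cos ξ := by
    rw [mul_comm, Complex.exp_ofReal_mul_I_re]
  have hsq := Real.sin_sq_eq_half_sub (ξ / 2)
  rw [mul_div_cancel₀ ξ two_ne_zero] at hsq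
  refine Or.inl ?_
  rw [Complex.sub_re, Complex.one_re, hre]
  nlinarith [sq_pos_of_pos h]

theorem integral_exp_mul_one_sub_exp_cpow {δ : ℝ} (hδ : 0 < δ) (hδ' : δ < 1) (n : ℤ) :
    ∫ ξ in (0 : ℝ)..(2 * π), Complex.exp (Complex.I * (-n : ℤ) * ξ) *
        (1 - Complex.exp (Complex.I * ξ)) ^ (-(δ : ℂ)) = 2 * π * gammaCoef δ n := by
  have hr : ∀ᶠ r : ℝ in nhdsWithin (1 : ℝ) (Set.Iio 1), r ∈ Set.Ico 0 1 := Ico_mem_nhdsLT one_pos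
  have hIoo : ∀ᵐ ξ : ℝ, ξ ∈ Set.uIoc 0 (2 * π) → ξ ∈ Set.Ioo 0 (2 * π) := by
    filter_upwards [MeasureTheory.Measure.ae_ne MeasureTheory.volume (2 * π)] with ξ hne hξ
    rw [Set.uIoc_of_le (by positivity)] at hξ
    exact ⟨hξ.1, hξ.2.lt_of_ne hne⟩
  have hlim := intervalIntegral.tendsto_integral_filter_of_dominated_convergence
    (μ := MeasureTheory.volume) (a := 0) (b := 2 * π) (l := nhdsWithin (1 : ℝ) (Set.Iio 1))
    (F := fun (r : ℝ) (ξ : ℝ) => Complex.exp (Complex.I * (-n : ℤ) * ξ) *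
        (1 - r * Complex.exp (Complex.I * ξ)) ^ (-(δ : ℂ)))
    (f := fun ξ : ℝ => Complex.exp (Complex.I * (-n : ℤ) * ξ) *
        (1 - Complex.exp (Complex.I * ξ)) ^ (-(δ : ℂ)))
    (fun ξ => (1 / 2) ^ (-δ) * ‖1 - Complex.exp (Complex.I * ξ)‖ ^ (-δ))
    (Filter.Eventually.of_forall fun r => by
      have : Measurable fun ξ : ℝ => 1 - r * Complex.exp (Complex.I * ξ) := by fun_prop
      refine Measurable.aestronglyMeasurable (Measurable.mul ?_ (this.pow_const _))
      fun_prop)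
    (by
      filter_upwards [hr] with r hr
      filter_upwards [hIoo] with ξ hξ hmem
      have hpos := norm_one_sub_exp_I_mul_pos (hξ hmem)
      have hnorm := norm_exp_I_mul 1 ξ
      rw [Int.cast_one, mul_one] at hnorm
      have hle := norm_one_sub_le_two_mul_norm_one_sub_mul hnorm hr.2.le hr.1
      rw [norm_mul, norm_exp_I_mul, one_mul, ← Complex.ofReal_neg, Complex.norm_cpow_real,
        ← Real.mul_rpow (by norm_num) hpos.le]
      exact Real.rpow_le_rpow_of_nonpos (by positivity) (by linarith) (by linarith))
    ((intervalIntegrable_norm_one_sub_exp_rpow (by linarith) (by linarith)).const_mul _)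
    (by
      filter_upwards [hIoo] with ξ hξ hmem
      have hcont : ContinuousAt (fun r : ℝ => Complex.exp (Complex.I * (-n : ℤ) * ξ) *
          (1 - r * Complex.exp (Complex.I * ξ)) ^ (-(δ : ℂ))) 1 := by
        refine continuousAt_const.mul (ContinuousAt.cpow (by fun_prop) continuousAt_const ?_)
        simpa using one_sub_exp_I_mul_mem_slitPlane (hξ hmem)
      simpa using hcont.tendsto.mono_left nhdsWithin_le_nhds)
  have hpow : Filter.Tendsto (fun r : ℝ => 2 * π * (gammaCoef δ n * (r : ℂ) ^ n.toNat)) (nhdsWithin 1 (Set.Iio 1))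
      (nhds (2 * π * gammaCoef δ n)) := by
    have hcont : Continuous fun r : ℝ => 2 * π * (gammaCoef δ n * (r : ℂ) ^ n.toNat) := by fun_prop
    simpa using (hcont.tendsto 1).mono_left nhdsWithin_le_nhds
  refine tendsto_nhds_unique hlim (hpow.congr' ?_)
  filter_upwards [hr] with r hr
  exact (integral_exp_mul_one_sub_mul_exp_cpow hδ n hr.1 hr.2).symm

theorem memLp_one_sub_exp_cpow {δ : ℝ} (hδ : δ ∈ Set.Ioo (0 : ℝ) (1 / 2)) :
    MeasureTheory.MemLp (fun ξ : ℝ => (1 - Complex.exp (Complex.I * ξ)) ^ (-(δ : ℂ))) 2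
      (MeasureTheory.volume.restrict (Set.Ioc 0 (2 * π))) := by
  have hm : Measurable fun ξ : ℝ => 1 - Complex.exp (Complex.I * ξ) := by fun_prop
  rw [MeasureTheory.memLp_two_iff_integrable_sq_norm (hm.pow_const _).aestronglyMeasurable]
  have h := intervalIntegrable_norm_one_sub_exp_rpow (s := -δ * 2) (by linarith [hδ.1])
    (by linarith [hδ.2])
  rw [intervalIntegrable_iff_integrableOn_Ioc_of_le (by positivity)] at h
  refine h.congr (Filter.Eventually.of_forall fun ξ => ?_)
  simp only [← Complex.ofReal_neg, Complex.norm_cpow_real, Real.rpow_mul (norm_nonneg _),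
    Real.rpow_two]

theorem fourierCoeffOn_zero_two_pi (f : ℝ → ℂ) (n : ℤ) :
    fourierCoeffOn Real.two_pi_pos f n =
      (2 * π : ℂ)⁻¹ * ∫ ξ in (0 : ℝ)..(2 * π), Complex.exp (Complex.I * (-n : ℤ) * ξ) * f ξ := by
  rw [fourierCoeffOn_eq_integral, sub_zero, Complex.real_smul, one_div]
  push_cast
  congr 1
  refine intervalIntegral.integral_congr fun ξ _ => ?_
  simp only [fourier_coe_apply, smul_eq_mul]
  congr 2
  push_cast
  field_simp [Real.pi_ne_zero]

theorem fourierCoeffOn_partialSum_sub {δ : ℝ} (hδ : δ ∈ Set.Ioo (0 : ℝ) (1 / 2)) (N : ℕ) (n : ℤ) :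
    fourierCoeffOn Real.two_pi_pos (fun ξ : ℝ => (∑ p ∈ Finset.range (N + 1),
        (gammaCoef δ (p : ℤ) : ℂ) * Complex.exp (Complex.I * (p : ℂ) * (ξ : ℂ))) -
          (1 - Complex.exp (Complex.I * (ξ : ℂ))) ^ (-(δ : ℂ))) n =
      if n ≤ N then 0 else -(gammaCoef δ n : ℂ) := by
  have hf : IntervalIntegrable (fun ξ : ℝ => Complex.exp (Complex.I * (-n : ℤ) * ξ) *
      (1 - Complex.exp (Complex.I * ξ)) ^ (-(δ : ℂ))) MeasureTheory.volume 0 (2 * π) := by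
    have h := (memLp_one_sub_exp_cpow hδ).integrable one_le_two
    refine IntervalIntegrable.continuousOn_mul ?_ (by fun_prop)
    rwa [intervalIntegrable_iff_integrableOn_Ioc_of_le (by positivity)]
  have hexp (p : ℕ) (ξ : ℝ) : Complex.exp (Complex.I * (-n : ℤ) * ξ) *
      ((gammaCoef δ (p : ℤ) : ℂ) * Complex.exp (Complex.I * (p : ℂ) * (ξ : ℂ))) =
      gammaCoef δ p * Complex.exp (Complex.I * (p - n : ℤ) * ξ) := by
    rw [mul_left_comm, ← Complex.exp_add]
    push_cast
    ring_nf
  have hπ : (2 * π : ℂ) ≠ 0 := by simp [Real.pi_ne_zero]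
  simp only [fourierCoeffOn_zero_two_pi, mul_sub, Finset.mul_sum, hexp]
  rw [intervalIntegral.integral_sub (Continuous.intervalIntegrable (by fun_prop) _ _) hf,
    integral_exp_mul_one_sub_exp_cpow hδ.1 (by linarith [hδ.2]),
    intervalIntegral.integral_finsetSum
      (fun p _ => Continuous.intervalIntegrable (by fun_prop) _ _)]
  simp only [intervalIntegral.integral_const_mul, integral_exp_I_mul_int_mul]
  rcases lt_or_ge n 0 with hn | hn
  · have hne (p : ℕ) : (p : ℤ) - n ≠ 0 := by omega
    simp [hne, gammaCoef, hn.ne, hn.not_gt]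
  · lift n to ℕ using hn
    simp only [sub_eq_zero, Nat.cast_inj, mul_ite, mul_zero, Finset.sum_ite_eq', Finset.mem_range,
      Order.lt_add_one_iff, Nat.cast_le]
    split_ifs
    · ring
    · field_simp
      ring

/-- The partial sums `S_N(ξ) = ∑_{p=0}^N γ_p^{(δ)} e^{ipξ}` converge in `L²([0,2π])`
to `ξ ↦ (1 - e^{iξ})^{-δ}` (principal branch complex power). -/
theorem partialSums_tendsto_L2 (δ : ℝ) (hδ : δ ∈ Set.Ioo (0 : ℝ) (1 / 2)) :
    Filter.Tendsto
      (fun N : ℕ =>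
        ∫ ξ in (0 : ℝ)..(2 * Real.pi),
          ‖(∑ p ∈ Finset.range (N + 1),
              ((gammaCoef δ (p : ℤ) : ℝ) : ℂ) * Complex.exp (Complex.I * (p : ℂ) * (ξ : ℂ))) -
            (1 - Complex.exp (Complex.I * (ξ : ℂ))) ^ (-(δ : ℂ))‖ ^ 2)
      Filter.atTop (nhds 0) := by
  have hcoeff := fourierCoeffOn_partialSum_sub hδ
  have hsq (N : ℕ) := hasSum_sq_fourierCoeffOn Real.two_pi_pos
    (f := fun ξ : ℝ => (∑ p ∈ Finset.range (N + 1),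
        ((gammaCoef δ (p : ℤ) : ℝ) : ℂ) * Complex.exp (Complex.I * (p : ℂ) * (ξ : ℂ))) -
          (1 - Complex.exp (Complex.I * (ξ : ℂ))) ^ (-(δ : ℂ)))
    (by
      refine MeasureTheory.MemLp.sub ?_ (memLp_one_sub_exp_cpow hδ)
      have hcont : Continuous fun ξ : ℝ => ∑ p ∈ Finset.range (N + 1),
          ((gammaCoef δ (p : ℤ) : ℝ) : ℂ) * Complex.exp (Complex.I * (p : ℂ) * (ξ : ℂ)) := by
        fun_prop
      rw [MeasureTheory.memLp_two_iff_integrable_sq_norm hcont.aestronglyMeasurable]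
      exact (hcont.norm.pow 2).integrableOn_Ioc)
  have hbound : Summable fun n : ℤ => ‖fourierCoeffOn Real.two_pi_pos
      (fun ξ : ℝ => (1 - Complex.exp (Complex.I * (ξ : ℂ))) ^ (-(δ : ℂ))) n‖ ^ 2 :=
    (hasSum_sq_fourierCoeffOn Real.two_pi_pos (memLp_one_sub_exp_cpow hδ)).summable
  have hπ : (2 * π : ℂ) ≠ 0 := by simp [Real.pi_ne_zero]
  simp only [fourierCoeffOn_zero_two_pi, integral_exp_mul_one_sub_exp_cpow hδ.1
    (by linarith [hδ.2] : δ < 1), inv_mul_cancel_left₀ hπ] at hbound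
  have htail := tendsto_tsum_of_dominated_convergence (𝓕 := Filter.atTop) hbound
    (f := fun (N : ℕ) (n : ℤ) => ‖(if n ≤ N then 0 else -(gammaCoef δ n : ℂ))‖ ^ 2)
    (g := fun _ => 0)
    (fun n => by
      refine tendsto_const_nhds.congr' ?_
      filter_upwards [Filter.eventually_ge_atTop n.toNat] with N hN
      simp [Int.toNat_le.mp hN])
    (Filter.Eventually.of_forall fun N n => by
      split_ifs <;> simp [sq_nonneg])
  rw [tsum_zero] at htail
  have hfinal := htail.const_mul (2 * π)
  rw [mul_zero] at hfinal
  refine hfinal.congr fun N => ?_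
  have h := (hsq N).tsum_eq
  simp only [hcoeff, sub_zero, smul_eq_mul] at h
  rw [h, mul_inv_cancel_left₀ Real.two_pi_pos.ne']
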